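/- Let w : ℝⁿ → ℝ be differentiable with w(0) = 0, let S ⊆ ℝⁿ be a convex set containing 0, and suppose there are constants ρ₁, …, ρₙ ≥ 0 such that |∂w/∂xⱼ(z)| ≤ ρⱼ for every z ∈ S and every coordinate j. Then for every x ∈ S there exists a coefficient vector δ ∈ ℝⁿ with |δⱼ| ≤ ρⱼ for all j such that w(x) = Σⱼ δⱼ·xⱼ (a structured uncertainty representation of w as a linear function with individually bounded coefficients). -/

import Mathlib

open RealInnerProductSpace

/-- Structured uncertainty representation: if `w : ℝⁿ → ℝ` is differentiable, `w 0 = 0`,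
`S` is convex with `0 ∈ S`, and each partial derivative satisfies `|∂w/∂xⱼ(z)| ≤ ρⱼ` on `S`,
then every `x ∈ S` admits a representation `w x = Σⱼ δⱼ * xⱼ` with `|δⱼ| ≤ ρⱼ`. -/
theorem structured_uncertainty_representation
    (n : ℕ) (w : EuclideanSpace ℝ (Fin n) → ℝ)
    (hdiff : Differentiable ℝ w)
    (h0 : w 0 = 0)
    (S : Set (EuclideanSpace ℝ (Fin n)))
    (hconv : Convex ℝ S) (h0S : (0 : EuclideanSpace ℝ (Fin n)) ∈ S)
    (ρ : Fin n → ℝ) (hρ : ∀ j, 0 ≤ ρ j)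
    (hbound : ∀ z ∈ S, ∀ j : Fin n, |gradient w z j| ≤ ρ j) :
    ∀ x ∈ S, ∃ δ : Fin n → ℝ, (∀ j, |δ j| ≤ ρ j) ∧ w x = ∑ j, δ j * x j := by
  intro x hx
  obtain ⟨z, hz, hzeq⟩ := domain_mvt (f := w) (s := S)
    (f' := fun y => InnerProductSpace.toDual ℝ _ (gradient w y))
    (fun y _ => (hdiff y).hasGradientAt.hasFDerivAt.hasFDerivWithinAt) hconv h0S hx
  refine ⟨fun j => gradient w z j, hbound z (hconv.segment_subset h0S hx hz), ?_⟩
  rw [h0, sub_zero, sub_zero, InnerProductSpace.toDual_apply_apply, PiLp.inner_apply] at hzeq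
  rw [hzeq]
  refine Finset.sum_congr rfl fun j _ => ?_
  simp [mul_comm]
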